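/- Let q be odd. There is no set L of q + k lines of AG(2,q) with the following properties: k is an odd positive integer, there is a set S of m points of the line at infinity ℓ∞ with 4 ≤ m ≤ q − 1 such that exactly k lines of L pass through each point of S, and the number of affine points contained in an odd number of lines of L equals q − k. -/

import Mathlib

/-- Lines of the affine plane `AG(2,F)`: either a non-vertical line `y = m·x + c`
(with slope `m`, i.e. direction `(m)` at infinity) or a vertical line `x = c`
(with direction `(∞)` at infinity). -/
inductive AffLine (F : Type*) where
  | slope (m c : F)
  | vert (c : F)
deriving DecidableEq

/-- Incidence between an affine point and an affine line. -/
def onAffLine {F : Type*} [Field F] (P : F × F) : AffLine F → Prop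
  | .slope m c => P.2 = m * P.1 + c
  | .vert c => P.1 = c

/-- The direction (point at infinity) of an affine line: `some m` is the direction `(m)`
of the lines of slope `m`, and `none` is the direction `(∞)` of the vertical lines;
the points of the line at infinity `ℓ∞` are exactly these directions. -/
def dirOf {F : Type*} : AffLine F → Option F
  | .slope m _ => some m
  | .vert _ => none

open Finset in
/-- In a field of odd order, the product of `(x - s) / (x - t)` over all `x ≠ s, t` is `-1`. -/
theorem prod_sub_div_sub_eq_neg_one {F : Type*} [Field F] [Fintype F] [DecidableEq F]
    (hq : Odd (Fintype.card F)) {s t : F} (hst : s ≠ t) :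
    ∏ x ∈ univ \ {s, t}, ((x - s) / (x - t)) = -1 := by
  have hcard : Odd #(univ \ {s, t} : Finset F) := by
    have h2 : #({s, t} : Finset F) = 2 := card_pair hst
    have h := card_sdiff_add_card_eq_card (subset_univ ({s, t} : Finset F))
    rw [h2, card_univ] at h
    rw [← h] at hq
    exact (Nat.odd_add.mp hq).mpr even_two
  have hflip : ∏ x ∈ univ \ {s, t}, (x - s) = ∏ x ∈ univ \ {s, t}, (-(x - t)) := by
    refine prod_nbij' (fun x ↦ s + t - x) (fun x ↦ s + t - x) ?_ ?_ ?_ ?_ ?_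
    · intro x hx
      simp only [mem_sdiff, mem_univ, true_and, mem_insert, mem_singleton, not_or] at hx ⊢
      exact ⟨fun h ↦ hx.2 (by linear_combination -h), fun h ↦ hx.1 (by linear_combination -h)⟩
    · intro x hx
      simp only [mem_sdiff, mem_univ, true_and, mem_insert, mem_singleton, not_or] at hx ⊢
      exact ⟨fun h ↦ hx.2 (by linear_combination -h), fun h ↦ hx.1 (by linear_combination -h)⟩
    · intro x _; ring
    · intro x _; ring
    · intro x _; ring
  have hne : ∏ x ∈ univ \ {s, t}, (x - t) ≠ 0 := by
    refine prod_ne_zero_iff.mpr fun x hx ↦ ?_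
    simp only [mem_sdiff, mem_univ, true_and, mem_insert, mem_singleton, not_or] at hx
    exact sub_ne_zero.mpr hx.2
  rw [prod_div_distrib, hflip, prod_neg, hcard.neg_one_pow]
  field_simp

namespace AffLine

@[simp]
theorem dirOf_slope {F : Type*} (m c : F) : dirOf (slope m c) = some m := rfl

@[simp]
theorem dirOf_vert {F : Type*} (c : F) : dirOf (vert c) = none := rfl

variable {F : Type*} [Field F]

/-- The first coordinate of the common point of the line `y = a * x + c` and a line of a different
direction. -/
def meetX (a c : F) : AffLine F → F
  | .slope m b => (b - c) / (a - m)
  | .vert e => e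

theorem onAffLine_iff_meetX_eq {a c x : F} {l : AffLine F} (hl : dirOf l ≠ some a) :
    onAffLine (x, a * x + c) l ↔ meetX a c l = x := by
  cases l with
  | slope m b =>
    have hm : a - m ≠ 0 := fun h ↦ hl (by simp [sub_eq_zero.mp h])
    simp only [onAffLine, meetX, div_eq_iff hm]
    constructor <;> intro h <;> linear_combination -h
  | vert e => simp only [onAffLine, meetX, eq_comm]

/-- Up to sign, the determinant of the coordinate vectors of the lines `l`, `y = a * x + c` and
`y = a' * x + c'`; it vanishes when the three lines are concurrent or parallel. -/
def det (a c a' c' : F) : AffLine F → F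
  | .slope m b => (b - c) * (a - a') - (c' - c) * (a - m)
  | .vert e => e * (a - a') - (c' - c)

theorem det_swap (a c a' c' : F) (l : AffLine F) : det a' c' a c l = -det a c a' c' l := by
  cases l <;> simp only [det] <;> ring

theorem det_eq_zero_iff {a c a' c' : F} {l : AffLine F} (ha : a ≠ a') (hl : dirOf l ≠ some a) :
    det a c a' c' l = 0 ↔ meetX a c l = meetX a c (.slope a' c') := by
  have ha' : a - a' ≠ 0 := sub_ne_zero.mpr ha
  cases l with
  | slope m b =>
    have hm : a - m ≠ 0 := fun h ↦ hl (by simp [sub_eq_zero.mp h])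
    simp only [det, meetX, div_eq_div_iff hm ha', sub_eq_zero]
  | vert e => simp only [det, meetX, eq_div_iff ha', sub_eq_zero]

theorem det_ne_zero_of_parallel {a c a' c' : F} {l : AffLine F} (ha : a ≠ a')
    (hl : dirOf l = some a) (hne : l ≠ .slope a c) : det a c a' c' l ≠ 0 := by
  cases l with
  | slope m b =>
    obtain rfl : m = a := by simpa using hl
    have hb : b - c ≠ 0 := fun h ↦ hne (by rw [sub_eq_zero.mp h])
    simpa [det] using ⟨hb, sub_ne_zero.mpr ha⟩
  | vert e => simp at hl

/-- The ratio in which a line `l` divides the side `y = a * x + c` of a triangle whose other sides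
are `y = a₁ * x + c₁` and `y = a₂ * x + c₂`. -/
def sideRatio (a c a₁ c₁ a₂ c₂ : F) (l : AffLine F) : F :=
  (det a c a₁ c₁ l * (a - a₂)) / (det a c a₂ c₂ l * (a - a₁))

theorem sideRatio_of_parallel {a c a₁ c₁ a₂ c₂ : F} {l : AffLine F} (h₁ : a ≠ a₁) (h₂ : a ≠ a₂)
    (hl : dirOf l = some a) (hne : l ≠ .slope a c) : sideRatio a c a₁ c₁ a₂ c₂ l = 1 := by
  have hd₂ := det_ne_zero_of_parallel (c' := c₂) h₂ hl hne
  have h₁' := sub_ne_zero.mpr h₁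
  rw [sideRatio, div_eq_one_iff_eq (mul_ne_zero hd₂ h₁')]
  cases l with
  | slope m b =>
    obtain rfl : m = a := by simpa using hl
    simp only [det]
    ring
  | vert e => simp at hl

theorem sideRatio_of_not_parallel {a c a₁ c₁ a₂ c₂ : F} {l : AffLine F} (h₁ : a ≠ a₁)
    (h₂ : a ≠ a₂) (hl : dirOf l ≠ some a) :
    sideRatio a c a₁ c₁ a₂ c₂ l = (meetX a c l - meetX a c (.slope a₁ c₁)) /
      (meetX a c l - meetX a c (.slope a₂ c₂)) := by
  have h₁' := sub_ne_zero.mpr h₁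
  have h₂' := sub_ne_zero.mpr h₂
  cases l with
  | slope m b =>
    have hm : a - m ≠ 0 := fun h ↦ hl (by simp [sub_eq_zero.mp h])
    simp only [sideRatio, det, meetX]
    rw [div_sub_div _ _ hm h₁', div_sub_div _ _ hm h₂']
    field_simp
  | vert e =>
    simp only [sideRatio, det, meetX]
    rw [sub_div' h₁', sub_div' h₂']
    field_simp

/-- Menelaus' theorem. -/
theorem sideRatio_mul_sideRatio_mul_sideRatio {a₁ c₁ a₂ c₂ a₃ c₃ : F} {l : AffLine F}
    (h₁₂ : a₁ ≠ a₂) (h₁₃ : a₁ ≠ a₃) (h₂₃ : a₂ ≠ a₃)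
    (hd₁₂ : det a₁ c₁ a₂ c₂ l ≠ 0) (hd₁₃ : det a₁ c₁ a₃ c₃ l ≠ 0)
    (hd₂₃ : det a₂ c₂ a₃ c₃ l ≠ 0) :
    sideRatio a₁ c₁ a₂ c₂ a₃ c₃ l * sideRatio a₂ c₂ a₃ c₃ a₁ c₁ l *
      sideRatio a₃ c₃ a₁ c₁ a₂ c₂ l = 1 := by
  simp only [sideRatio]
  rw [det_swap a₁ c₁ a₂ c₂, det_swap a₁ c₁ a₃ c₃, det_swap a₂ c₂ a₃ c₃,
    ← neg_sub a₁ a₂, ← neg_sub a₁ a₃, ← neg_sub a₂ a₃]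
  have := sub_ne_zero.mpr h₁₂
  have := sub_ne_zero.mpr h₁₃
  have := sub_ne_zero.mpr h₂₃
  field_simp

open Finset

variable [DecidableEq F]

theorem det_ne_zero_of_bijOn {L : Finset (AffLine F)} {a c a₁ c₁ : F}
    (hbij : Set.BijOn (meetX a c) (L.filter (dirOf · ≠ some a)) Set.univ) (h : a ≠ a₁)
    (hl₁ : slope a₁ c₁ ∈ L) {l : AffLine F} (hl : l ∈ L) (hne : l ≠ slope a c)
    (hne₁ : l ≠ slope a₁ c₁) : det a c a₁ c₁ l ≠ 0 := by
  by_cases hd : dirOf l = some a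
  · exact det_ne_zero_of_parallel h hd hne
  · rw [Ne, det_eq_zero_iff h hd]
    exact fun heq ↦ hne₁ (hbij.injOn (by simp [hl, hd]) (by simp [hl₁, h.symm]) heq)

variable [Fintype F]

/-- Every line of `L` whose direction carries exactly `k` lines of `L` meets the lines of `L` of
other directions in pairwise distinct points, and these are all its affine points. -/
theorem meetX_bijOn_of_card_odd {k : ℕ} (hq : Odd (Fintype.card F))
    {L : Finset (AffLine F)} (hL : #L = Fintype.card F + k) {a c : F}
    (hthru : {l : AffLine F | l ∈ L ∧ dirOf l = some a}.ncard = k)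
    (hodd : ({P : F × F | Odd {l : AffLine F | l ∈ L ∧ onAffLine P l}.ncard}.ncard : ℤ)
      = (Fintype.card F : ℤ) - (k : ℤ))
    (hc : slope a c ∈ L) :
    Set.BijOn (meetX a c) (L.filter (dirOf · ≠ some a)) Set.univ := by
  classical
  set M := L.filter (dirOf · ≠ some a) with hM
  have hpar : #(L.filter (dirOf · = some a)) = k := by
    rw [← hthru, ← Set.ncard_coe_finset, coe_filter]
  have hMcard : #M = Fintype.card F := by
    have : #(L.filter (dirOf · = some a)) + #M = #L :=
      card_filter_add_card_filter_not (dirOf · = some a)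
    omega
  have hmult : ∀ x b : F, {l : AffLine F | l ∈ L ∧ onAffLine (x, a * x + b) l}.ncard =
      #(M.filter (meetX a b · = x)) + if slope a b ∈ L then 1 else 0 := by
    intro x b
    have hset : {l : AffLine F | l ∈ L ∧ onAffLine (x, a * x + b) l} =
        ((M.filter (meetX a b · = x) ∪ L.filter (· = slope a b) : Finset (AffLine F)) :
          Set (AffLine F)) := by
      ext l
      simp only [Set.mem_ofPred_eq, hM, coe_union, coe_filter, mem_filter, Set.mem_union]
      by_cases hl : dirOf l = some a
      · cases l with
        | slope m e =>
          obtain rfl : m = a := by simpa using hl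
          simp [onAffLine, eq_comm]
        | vert e => simp at hl
      · have hne : l ≠ slope a b := fun h ↦ hl (by simp [h])
        simp [onAffLine_iff_meetX_eq hl, hl, hne]
    rw [hset, Set.ncard_coe_finset, card_union_of_disjoint, filter_eq']
    · split_ifs <;> simp
    · rw [disjoint_left]
      intro l hl hl'
      simp only [hM, mem_filter] at hl hl'
      exact hl.1.2 (by simp [hl'.2])
  set O : Finset (F × F) :=
    univ.filter fun P ↦ Odd {l : AffLine F | l ∈ L ∧ onAffLine P l}.ncard with hO
  have hOcard : (#O : ℤ) = Fintype.card F - k := by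
    rw [← hodd, ← Set.ncard_coe_finset, hO, coe_filter]
    simp
  set N : Finset F := univ.filter fun b ↦ slope a b ∉ L with hN
  have hNcard : #N + k = Fintype.card F := by
    have hk' : #(univ.filter fun b ↦ slope a b ∈ L) = k := by
      rw [← hpar]
      refine card_nbij (slope a) ?_ ?_ ?_
      · intro b hb; simpa using hb
      · intro b _ b' _ h; simpa using h
      · rintro (⟨m, e⟩ | e) hl
        · obtain ⟨hl, rfl⟩ : slope m e ∈ L ∧ m = a := by simpa using hl
          exact ⟨e, by simpa using hl, rfl⟩
        · simp at hl
    have : #(univ.filter fun b ↦ slope a b ∈ L) + #N = #(univ : Finset F) :=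
      card_filter_add_card_filter_not (slope a · ∈ L)
    rw [hk', card_univ] at this
    omega
  have hsub : N ⊆ O.image fun P ↦ P.2 - a * P.1 := by
    intro b hb
    have hb : slope a b ∉ L := by simpa [hN] using hb
    have hsum := card_eq_sum_card_fiberwise (f := meetX a b) (s := M) (t := univ) (by simp)
    obtain ⟨x, -, hx⟩ : ∃ x ∈ univ, Odd #(M.filter (meetX a b · = x)) := by
      by_contra! hcon
      rw [hMcard] at hsum
      rw [hsum] at hq
      exact Nat.not_even_iff_odd.mpr hq
        (even_sum _ fun x hx ↦ Nat.not_odd_iff_even.mp (hcon x hx))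
    refine mem_image.mpr ⟨(x, a * x + b), ?_, by ring⟩
    simpa [hO, hmult, hb] using hx
  have himage : N = O.image fun P ↦ P.2 - a * P.1 := by
    refine eq_of_subset_of_card_le hsub (card_image_le.trans ?_)
    omega
  have hsurj : Set.SurjOn (meetX a c) M Set.univ := by
    intro x _
    have hx : (x, a * x + c) ∉ O := fun h ↦ by
      have : c ∈ N := by
        rw [himage]
        exact mem_image.mpr ⟨_, h, by ring⟩
      simp [hN, hc] at this
    have hx' : Odd #(M.filter (meetX a c · = x)) := by
      simpa [hO, hmult, hc, Nat.even_add_one] using hx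
    obtain ⟨l, hl⟩ := card_pos.mp hx'.pos
    rw [mem_filter] at hl
    exact ⟨l, hl.1, hl.2⟩
  have hinj : Set.InjOn (meetX a c) M :=
    injOn_of_surjOn_of_card_le (t := univ) _ (by simp [Set.MapsTo]) (by simpa using hsurj)
      (by simp [hMcard])
  exact ⟨Set.mapsTo_univ _ _, hinj, hsurj⟩

theorem prod_sideRatio_of_bijOn (hq : Odd (Fintype.card F)) {L : Finset (AffLine F)}
    {a c a₁ c₁ a₂ c₂ : F}
    (hbij : Set.BijOn (meetX a c) (L.filter (dirOf · ≠ some a)) Set.univ)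
    (h₁ : a ≠ a₁) (h₂ : a ≠ a₂) (h₁₂ : a₁ ≠ a₂)
    (hl₁ : slope a₁ c₁ ∈ L) (hl₂ : slope a₂ c₂ ∈ L) :
    ∏ l ∈ L \ {slope a c, slope a₁ c₁, slope a₂ c₂}, sideRatio a c a₁ c₁ a₂ c₂ l = -1 := by
  have hm₁ : slope a₁ c₁ ∈ L.filter (dirOf · ≠ some a) := by simp [hl₁, h₁.symm]
  have hm₂ : slope a₂ c₂ ∈ L.filter (dirOf · ≠ some a) := by simp [hl₂, h₂.symm]
  have hst : meetX a c (slope a₁ c₁) ≠ meetX a c (slope a₂ c₂) := fun h ↦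
    h₁₂ (slope.inj (hbij.injOn hm₁ hm₂ h)).1
  rw [← prod_sub_div_sub_eq_neg_one hq hst]
  have hsub : L.filter (dirOf · ≠ some a) \ {slope a₁ c₁, slope a₂ c₂} ⊆
      L \ {slope a c, slope a₁ c₁, slope a₂ c₂} := by
    intro l hl
    simp only [mem_sdiff, mem_filter, mem_insert, mem_singleton] at hl ⊢
    refine ⟨hl.1.1, ?_⟩
    rintro (rfl | h)
    · exact hl.1.2 rfl
    · exact hl.2 h
  rw [← prod_subset hsub]
  · refine prod_nbij (meetX a c) ?_ ?_ ?_ ?_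
    · intro l hl
      simp only [mem_sdiff, mem_insert, mem_singleton, mem_univ, true_and, not_or] at hl ⊢
      exact ⟨fun h ↦ hl.2.1 (hbij.injOn hl.1 hm₁ h), fun h ↦ hl.2.2 (hbij.injOn hl.1 hm₂ h)⟩
    · exact hbij.injOn.mono fun l hl ↦ (mem_sdiff.mp hl).1
    · intro x hx
      obtain ⟨l, hl, rfl⟩ := hbij.surjOn (Set.mem_univ x)
      refine ⟨l, mem_sdiff.mpr ⟨hl, fun h ↦ (mem_sdiff.mp hx).2 ?_⟩, rfl⟩
      simp only [mem_insert, mem_singleton] at h ⊢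
      exact h.imp (congrArg _) (congrArg _)
    · intro l hl
      exact sideRatio_of_not_parallel h₁ h₂ (mem_filter.mp (mem_sdiff.mp hl).1).2
  · intro l hl hl'
    simp only [mem_sdiff, mem_filter, mem_insert, mem_singleton, not_or] at hl hl'
    refine sideRatio_of_parallel h₁ h₂ ?_ hl.2.1
    by_contra hd
    exact hl' ⟨⟨hl.1, hd⟩, hl.2.2⟩

end AffLine

open AffLine in
/-- Let `q` be odd.  There is no set `L` of `q + k` lines of `AG(2,q)` such that: `k` is an odd
positive integer, there is a set `S` of `m` points of the line at infinity with
`4 ≤ m ≤ q − 1` such that exactly `k` lines of `L` pass through each point of `S`, and the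
number of affine points contained in an odd number of lines of `L` equals `q − k`. -/
theorem stmt_19 {F : Type*} [Field F] [Fintype F] [DecidableEq F]
    (q : ℕ) (hq : Fintype.card F = q) (hqodd : Odd q)
    (k : ℕ) (hkodd : Odd k) (hkpos : 0 < k)
    (L : Finset (AffLine F)) (hL : L.card = q + k)
    (m : ℕ) (hm4 : 4 ≤ m) (hmq : m ≤ q - 1)
    (S : Finset (Option F)) (hS : S.card = m)
    (hthru : ∀ d ∈ S, {l : AffLine F | l ∈ L ∧ dirOf l = d}.ncard = k)
    (hodd : ({P : F × F | Odd {l : AffLine F | l ∈ L ∧ onAffLine P l}.ncard}.ncard : ℤ)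
      = (q : ℤ) - (k : ℤ)) :
    False := by
  subst hq
  have hthree : 2 < (Finset.eraseNone S).card := by
    have h := Finset.card_eraseNone_eq_card_erase S
    have h' := Finset.pred_card_le_card_erase (s := S) (a := none)
    omega
  obtain ⟨a₁, hs₁, a₂, hs₂, a₃, hs₃, h₁₂, h₁₃, h₂₃⟩ := Finset.two_lt_card.mp hthree
  rw [Finset.mem_eraseNone] at hs₁ hs₂ hs₃
  have hline : ∀ a : F, some a ∈ S → ∃ c, slope a c ∈ L := by
    intro a ha
    obtain ⟨l, hl, hd⟩ := Set.nonempty_of_ncard_ne_zero ((hthru _ ha).trans_ne hkpos.ne')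
    cases l with
    | slope m c =>
      obtain rfl : m = a := by simpa using hd
      exact ⟨c, hl⟩
    | vert e => simp at hd
  obtain ⟨c₁, hl₁⟩ := hline a₁ hs₁
  obtain ⟨c₂, hl₂⟩ := hline a₂ hs₂
  obtain ⟨c₃, hl₃⟩ := hline a₃ hs₃
  have hb₁ := meetX_bijOn_of_card_odd hqodd hL (hthru _ hs₁) hodd hl₁
  have hb₂ := meetX_bijOn_of_card_odd hqodd hL (hthru _ hs₂) hodd hl₂
  have hb₃ := meetX_bijOn_of_card_odd hqodd hL (hthru _ hs₃) hodd hl₃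
  have hp₁ := prod_sideRatio_of_bijOn hqodd hb₁ h₁₂ h₁₃ h₂₃ hl₂ hl₃
  have hp₂ := prod_sideRatio_of_bijOn hqodd hb₂ h₂₃ h₁₂.symm h₁₃.symm hl₃ hl₁
  have hp₃ := prod_sideRatio_of_bijOn hqodd hb₃ h₁₃.symm h₂₃.symm h₁₂ hl₁ hl₂
  have hrot₂ : ({slope a₂ c₂, slope a₃ c₃, slope a₁ c₁} : Finset (AffLine F)) =
      {slope a₁ c₁, slope a₂ c₂, slope a₃ c₃} := by
    ext; simp only [Finset.mem_insert, Finset.mem_singleton]; tauto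
  have hrot₃ : ({slope a₃ c₃, slope a₁ c₁, slope a₂ c₂} : Finset (AffLine F)) =
      {slope a₁ c₁, slope a₂ c₂, slope a₃ c₃} := by
    ext; simp only [Finset.mem_insert, Finset.mem_singleton]; tauto
  rw [hrot₂] at hp₂
  rw [hrot₃] at hp₃
  have hprod : (-1 : F) * -1 * -1 = 1 := by
    refine (congrArg₂ (· * ·) (congrArg₂ (· * ·) hp₁ hp₂) hp₃).symm.trans ?_
    rw [← Finset.prod_mul_distrib, ← Finset.prod_mul_distrib]
    refine Finset.prod_eq_one fun l hl ↦ ?_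
    simp only [Finset.mem_sdiff, Finset.mem_insert, Finset.mem_singleton, not_or] at hl
    obtain ⟨hl, hn₁, hn₂, hn₃⟩ := hl
    exact sideRatio_mul_sideRatio_mul_sideRatio h₁₂ h₁₃ h₂₃
      (det_ne_zero_of_bijOn hb₁ h₁₂ hl₂ hl hn₁ hn₂)
      (det_ne_zero_of_bijOn hb₁ h₁₃ hl₃ hl hn₁ hn₃)
      (det_ne_zero_of_bijOn hb₂ h₂₃ hl₃ hl hn₂ hn₃)
  have hchar : ringChar F ≠ 2 := fun h ↦
    Nat.not_even_iff_odd.mpr hqodd (FiniteField.even_card_iff_char_two.mp h |> Nat.even_iff.mpr)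
  exact Ring.neg_one_ne_one_of_char_ne_two hchar (by linear_combination hprod)
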